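/- arXiv:1503.02885 — 3 statements merged into one kernel-verified Lean document; each statement's English description precedes it below -/
import Mathlib

section
/- Let k ≥ 3 be a positive integer. Then there is a constant c₁' = c₁'(k) > 0 such that for every large enough n the following holds: if M = ⌊n^{2−2/(k+1)}⌋, then the probability that a random graph G ~ G(T_{n,k}, M) contains no good copy of K_k is at most exp(−c₁'·M). -/
namespace TournamentGame

variable {V : Type*} [DecidableEq V]

/-- The underlying undirected edges of a set of oriented edges. -/
def undirect (M : Finset (V × V)) : Finset (Sym2 V) :=
  M.image fun p => s(p.1, p.2)

/-- `MakerWin X F b M B` : in the (1:b) Maker-Breaker game on board `X`, with Maker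
having claimed `M`, Breaker having claimed `B`, and Maker to move, Maker has a strategy
to claim all edges of some winning set (i.e. reach a position with `F` on her edges). -/
inductive MakerWin (X : Finset (Sym2 V)) (F : Finset (Sym2 V) → Prop) (b : ℕ) :
    Finset (Sym2 V) → Finset (Sym2 V) → Prop
  | win (M B : Finset (Sym2 V)) : F M → MakerWin X F b M B
  | move (M B : Finset (Sym2 V)) (e : Sym2 V) (heX : e ∈ X) (hefree : e ∉ M ∪ B)
      (h : ∀ B' : Finset (Sym2 V), B' ⊆ X \ (insert e M ∪ B) →
        B'.card = min b (X \ (insert e M ∪ B)).card →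
        MakerWin X F b (insert e M) (B ∪ B')) :
      MakerWin X F b M B

/-- `BreakerBlock X F b M B` : Maker to move; Breaker has a strategy ensuring that `F`
never holds on Maker's edge set. -/
inductive BreakerBlock (X : Finset (Sym2 V)) (F : Finset (Sym2 V) → Prop) (b : ℕ) :
    Finset (Sym2 V) → Finset (Sym2 V) → Prop
  | step (M B : Finset (Sym2 V)) (hF : ¬ F M) (resp : Sym2 V → Finset (Sym2 V))
      (hsub : ∀ e ∈ X, e ∉ M ∪ B → resp e ⊆ X \ (insert e M ∪ B))
      (hcard : ∀ e ∈ X, e ∉ M ∪ B → (resp e).card = min b (X \ (insert e M ∪ B)).card)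
      (h : ∀ e ∈ X, e ∉ M ∪ B → BreakerBlock X F b (insert e M) (B ∪ resp e)) :
      BreakerBlock X F b M B

/-- Oriented (tournament-game) version of `MakerWin`: Maker claims an edge together with
an orientation; her position is a set of oriented edges. -/
inductive OMakerWin (X : Finset (Sym2 V)) (F : Finset (V × V) → Prop) (b : ℕ) :
    Finset (V × V) → Finset (Sym2 V) → Prop
  | win (M : Finset (V × V)) (B : Finset (Sym2 V)) : F M → OMakerWin X F b M B
  | move (M : Finset (V × V)) (B : Finset (Sym2 V)) (x y : V)
      (heX : s(x, y) ∈ X) (hefree : s(x, y) ∉ undirect M ∪ B)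
      (h : ∀ B' : Finset (Sym2 V), B' ⊆ X \ (insert s(x, y) (undirect M) ∪ B) →
        B'.card = min b (X \ (insert s(x, y) (undirect M) ∪ B)).card →
        OMakerWin X F b (insert (x, y) M) (B ∪ B')) :
      OMakerWin X F b M B

/-- Oriented version of `BreakerBlock`. -/
inductive OBreakerBlock (X : Finset (Sym2 V)) (F : Finset (V × V) → Prop) (b : ℕ) :
    Finset (V × V) → Finset (Sym2 V) → Prop
  | step (M : Finset (V × V)) (B : Finset (Sym2 V)) (hF : ¬ F M)
      (resp : V → V → Finset (Sym2 V))
      (hsub : ∀ x y : V, s(x, y) ∈ X → s(x, y) ∉ undirect M ∪ B →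
        resp x y ⊆ X \ (insert s(x, y) (undirect M) ∪ B))
      (hcard : ∀ x y : V, s(x, y) ∈ X → s(x, y) ∉ undirect M ∪ B →
        (resp x y).card = min b (X \ (insert s(x, y) (undirect M) ∪ B)).card)
      (h : ∀ x y : V, s(x, y) ∈ X → s(x, y) ∉ undirect M ∪ B →
        OBreakerBlock X F b (insert (x, y) M) (B ∪ resp x y)) :
      OBreakerBlock X F b M B

/-- Position with Breaker to move, in the unoriented game: Breaker can respond and
then keep blocking forever. -/
def BreakerTurn (X : Finset (Sym2 V)) (F : Finset (Sym2 V) → Prop) (b : ℕ)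
    (M B : Finset (Sym2 V)) : Prop :=
  ¬ F M ∧ ∃ B' : Finset (Sym2 V), B' ⊆ X \ (M ∪ B) ∧
    B'.card = min b (X \ (M ∪ B)).card ∧ BreakerBlock X F b M (B ∪ B')

/-- Position with Breaker to move, in the oriented game. -/
def OBreakerTurn (X : Finset (Sym2 V)) (F : Finset (V × V) → Prop) (b : ℕ)
    (M : Finset (V × V)) (B : Finset (Sym2 V)) : Prop :=
  ¬ F M ∧ ∃ B' : Finset (Sym2 V), B' ⊆ X \ (undirect M ∪ B) ∧
    B'.card = min b (X \ (undirect M ∪ B)).card ∧ OBreakerBlock X F b M (B ∪ B')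

/-- Winning sets of the triangle game. -/
def HasTriangle (M : Finset (Sym2 V)) : Prop :=
  ∃ x y z : V, x ≠ y ∧ y ≠ z ∧ x ≠ z ∧ s(x, y) ∈ M ∧ s(y, z) ∈ M ∧ s(x, z) ∈ M

/-- Maker's oriented edges contain a cyclic (directed) triangle. -/
def HasCyclicTriangle (M : Finset (V × V)) : Prop :=
  ∃ x y z : V, x ≠ y ∧ y ≠ z ∧ x ≠ z ∧ (x, y) ∈ M ∧ (y, z) ∈ M ∧ (z, x) ∈ M

/-- Maker's oriented edges contain an acyclic (transitive) triangle. -/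
def HasAcyclicTriangle (M : Finset (V × V)) : Prop :=
  ∃ x y z : V, x ≠ y ∧ y ≠ z ∧ x ≠ z ∧ (x, y) ∈ M ∧ (y, z) ∈ M ∧ (x, z) ∈ M

/-- A tournament on `Fin k`, given by its arc relation. -/
def IsTournament {k : ℕ} (T : Fin k → Fin k → Prop) : Prop :=
  (∀ i, ¬ T i i) ∧ ∀ i j : Fin k, i ≠ j → (T i j ↔ ¬ T j i)

/-- Maker's oriented edges contain a copy of the tournament `T`. -/
def HasTCopy {k : ℕ} (T : Fin k → Fin k → Prop) (M : Finset (V × V)) : Prop :=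
  ∃ f : Fin k → V, Function.Injective f ∧ ∀ i j : Fin k, T i j → (f i, f j) ∈ M

/-- The edge set of the complete graph `K_n`. -/
def completeEdges (n : ℕ) : Finset (Sym2 (Fin n)) :=
  Finset.univ.filter fun e => ¬ e.IsDiag

/-- The edge set of the Turán graph `T_{n,k}` : classes are residues mod `k`. -/
def turanEdges (n k : ℕ) : Finset (Sym2 (Fin n)) :=
  Finset.univ.filter fun e => ¬ (e.map fun v : Fin n => v.val % k).IsDiag

/-- `A` contains a good copy of `K_k` (all vertices in distinct classes of `T_{n,k}`). -/
def GoodCopy (n k : ℕ) (A : Finset (Sym2 (Fin n))) : Prop :=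
  ∃ f : Fin k → Fin n, Function.Injective f ∧
    (∀ i j : Fin k, i ≠ j → (f i).val % k ≠ (f j).val % k) ∧
    (∀ i j : Fin k, i ≠ j → s(f i, f j) ∈ A)

open Classical in
/-- Probability that a `p`-random subset `A` of `E` (each element kept independently with
probability `p`) satisfies `P`. This is the model `G(E, p)`. -/
noncomputable def edgeProb {α : Type*} [DecidableEq α] (E : Finset α) (p : ℝ)
    (P : Finset α → Prop) : ℝ :=
  ∑ A ∈ E.powerset, if P A then p ^ A.card * (1 - p) ^ (E.card - A.card) else 0

open Classical in
/-- Probability that a uniformly random `M`-element subset of `E` satisfies `P`.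
This is the model `G(E, M)`. -/
noncomputable def uniformProb {α : Type*} [DecidableEq α] (E : Finset α) (M : ℕ)
    (P : Finset α → Prop) : ℝ :=
  ((E.powerset.filter fun A => A.card = M ∧ P A).card : ℝ) /
    ((E.powerset.filter fun A => A.card = M).card : ℝ)

/-- The three edges of a triangle on `x`, `y`, `z`. -/
def triEdges (x y z : V) : Finset (Sym2 V) := {s(x, y), s(y, z), s(x, z)}

/-- `x`, `y`, `z` form a triangle of the graph with edge set `A`. -/
def IsTriangleIn (A : Finset (Sym2 V)) (x y z : V) : Prop :=
  x ≠ y ∧ y ≠ z ∧ x ≠ z ∧ s(x, y) ∈ A ∧ s(y, z) ∈ A ∧ s(x, z) ∈ A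

/-- The triangles of `A`, each recorded as its set of three edges: the vertex set of `T_A`. -/
def TriSets (A : Finset (Sym2 V)) : Set (Finset (Sym2 V)) :=
  {t | ∃ x y z : V, IsTriangleIn A x y z ∧ t = triEdges x y z}

/-- `C` is a triangle collection: every edge lies in a triangle and the graph `T_C` of
triangles (adjacent iff sharing an edge) is connected. -/
def IsTriangleCollection (C : Finset (Sym2 V)) : Prop :=
  (∀ e ∈ C, ∃ x y z : V, IsTriangleIn C x y z ∧ e ∈ triEdges x y z) ∧
  ∀ t ∈ TriSets C, ∀ t' ∈ TriSets C,
    Relation.ReflTransGen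
      (fun a b => a ∈ TriSets C ∧ b ∈ TriSets C ∧ (a ∩ b).Nonempty) t t'

/-- Adjacency of `K₃⁺`: a triangle on `{0,1,2}` with a pendant edge `{2,3}`. -/
def K3plusAdj (a b : Fin 4) : Prop :=
  (a.val < 3 ∧ b.val < 3 ∧ a ≠ b) ∨ (a.val = 2 ∧ b.val = 3) ∨ (a.val = 3 ∧ b.val = 2)

/-- Adjacency of the path on `Fin m`. -/
def pathAdj {m : ℕ} (a b : Fin m) : Prop := a.val + 1 = b.val ∨ b.val + 1 = a.val

/-- `C` is very basic: `T_C` is (isomorphic to) a subgraph of `K₃⁺` or of a path `P_m`. -/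
def VeryBasic (C : Finset (Sym2 V)) : Prop :=
  (∃ φ : TriSets C → Fin 4, Function.Injective φ ∧
    ∀ t t' : TriSets C, t ≠ t' → ((t : Finset (Sym2 V)) ∩ (t' : Finset (Sym2 V))).Nonempty →
      K3plusAdj (φ t) (φ t')) ∨
  (∃ m : ℕ, ∃ φ : TriSets C → Fin m, Function.Injective φ ∧
    ∀ t t' : TriSets C, t ≠ t' → ((t : Finset (Sym2 V)) ∩ (t' : Finset (Sym2 V))).Nonempty →
      pathAdj (φ t) (φ t'))

/-- `C` is basic: there are distinct edges `e₁, e₂` with `C - eᵢ` very basic for both. -/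
def Basic (C : Finset (Sym2 V)) : Prop :=
  ∃ e₁ ∈ C, ∃ e₂ ∈ C, e₁ ≠ e₂ ∧ VeryBasic (C.erase e₁) ∧ VeryBasic (C.erase e₂)

open Classical in
/-- The set of non-isolated vertices of the graph with edge set `C`. -/
noncomputable def support [Fintype V] (C : Finset (Sym2 V)) : Finset V :=
  Finset.univ.filter fun v => ∃ e ∈ C, v ∈ e

open Classical in
/-- Degree of `v` in the graph with edge set `C`. -/
noncomputable def degreeIn (C : Finset (Sym2 V)) (v : V) : ℕ :=
  (C.filter fun e => v ∈ e).card

/-- The maximum density `m(C) = max_{H ⊆ C} e(H)/v(H)` is (strictly) less than `r`. -/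
def MaxDensityLt [Fintype V] (C : Finset (Sym2 V)) (r : ℝ) : Prop :=
  ∀ D ⊆ C, D.Nonempty → (D.card : ℝ) / ((support D).card : ℝ) < r

/-- The edge set of the `k`-wheel: a cycle on `{0, …, k-1} ⊆ Fin (k+1)` together with
all edges to the center, the vertex `k`. -/
def wheelEdges (k : ℕ) : Finset (Sym2 (Fin (k + 1))) :=
  ((Finset.univ : Finset (Fin k)).image fun i =>
    s((⟨i.val, by have := i.2; omega⟩ : Fin (k + 1)),
      (⟨(i.val + 1) % k, by have := i.2; exact Nat.lt_succ_of_lt (Nat.mod_lt _ (by omega))⟩ :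
        Fin (k + 1)))) ∪
  ((Finset.univ : Finset (Fin k)).image fun i =>
    s((⟨i.val, by have := i.2; omega⟩ : Fin (k + 1)), (Fin.last k)))


/-- Expectation of `f A` for a `p`-random subset `A` of `E`. -/
noncomputable def edgeExp {α : Type*} (E : Finset α) (p : ℝ)
    (f : Finset α → ℝ) : ℝ :=
  ∑ A ∈ E.powerset, p ^ A.card * (1 - p) ^ (E.card - A.card) * f A

section edgeExp
variable {α : Type*} {E : Finset α} {p : ℝ}

lemma edgeExp_mono (hp0 : 0 ≤ p) (hp1 : p ≤ 1) {f g : Finset α → ℝ}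
    (h : ∀ A ⊆ E, f A ≤ g A) : edgeExp E p f ≤ edgeExp E p g := by
  refine Finset.sum_le_sum fun A hA => ?_
  have : 0 ≤ 1 - p := by linarith
  exact mul_le_mul_of_nonneg_left (h A (Finset.mem_powerset.1 hA)) (by positivity)

lemma edgeExp_const (c : ℝ) : edgeExp E p (fun _ => c) = c := by
  unfold edgeExp
  rw [← Finset.sum_mul, Finset.sum_pow_mul_eq_add_pow]
  simp

lemma edgeExp_nonneg (hp0 : 0 ≤ p) (hp1 : p ≤ 1) {f : Finset α → ℝ} (h : ∀ A, 0 ≤ f A) :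
    0 ≤ edgeExp E p f :=
  (edgeExp_const (E := E) (p := p) 0).symm.le.trans (edgeExp_mono hp0 hp1 fun A _ => h A)

lemma edgeExp_sub (f g : Finset α → ℝ) :
    edgeExp E p (fun A => f A - g A) = edgeExp E p f - edgeExp E p g := by
  simp [edgeExp, mul_sub]

lemma edgeExp_mul_left (c : ℝ) (f : Finset α → ℝ) :
    edgeExp E p (fun A => c * f A) = c * edgeExp E p f := by
  unfold edgeExp
  rw [Finset.mul_sum]
  exact Finset.sum_congr rfl fun A _ => by ring

lemma edgeExp_sum {ι : Type*} (s : Finset ι) (f : ι → Finset α → ℝ) :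
    edgeExp E p (fun A => ∑ i ∈ s, f i A) = ∑ i ∈ s, edgeExp E p (f i) := by
  unfold edgeExp
  simp_rw [Finset.mul_sum]
  exact Finset.sum_comm

variable [DecidableEq α]

lemma edgeExp_mem {e : α} (he : e ∈ E) (f : Finset α → ℝ) :
    edgeExp E p (fun A => if e ∈ A then f A else 0) =
      p * edgeExp E p (fun A => f (insert e A)) := by
  obtain ⟨F, heF, rfl⟩ : ∃ F, e ∉ F ∧ insert e F = E :=
    ⟨E.erase e, Finset.notMem_erase e E, Finset.insert_erase he⟩
  have key : ∀ g : Finset α → ℝ, edgeExp (insert e F) p g =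
      ∑ A ∈ F.powerset, (p ^ A.card * (1 - p) ^ (F.card - A.card)) *
        ((1 - p) * g A + p * g (insert e A)) := by
    intro g
    unfold edgeExp
    rw [Finset.sum_powerset_insert heF, ← Finset.sum_add_distrib]
    refine Finset.sum_congr rfl fun A hA => ?_
    have hAF := Finset.mem_powerset.1 hA
    have heA : e ∉ A := fun h => heF (hAF h)
    have hc := Finset.card_le_card hAF
    rw [Finset.card_insert_of_notMem heF, Finset.card_insert_of_notMem heA,
      Nat.add_sub_add_right, Nat.sub_add_comm hc]
    ring
  rw [key, key, Finset.mul_sum]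
  refine Finset.sum_congr rfl fun A hA => ?_
  have heA : e ∉ A := fun h => heF (Finset.mem_powerset.1 hA h)
  simp [heA]
  ring

/-- Conditioning on `S ⊆ A` amounts to adding `S` to the random set. -/
lemma edgeExp_subset {S : Finset α} (hS : S ⊆ E) (f : Finset α → ℝ) :
    edgeExp E p (fun A => if S ⊆ A then f A else 0) =
      p ^ S.card * edgeExp E p (fun A => f (A ∪ S)) := by
  induction S using Finset.induction_on generalizing f with
  | empty => simp
  | insert e S heS ih =>
    have h1 : (fun A => if insert e S ⊆ A then f A else 0) =
        fun A => if e ∈ A then (if S ⊆ A then f A else 0) else 0 := by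
      funext A
      simp only [Finset.insert_subset_iff, ite_and]
    have h2 : (fun A => if S ⊆ insert e A then f (insert e A) else 0) =
        fun A => if S ⊆ A then f (insert e A) else 0 := by
      funext A
      simp only [Finset.subset_insert_iff_of_notMem heS]
    rw [h1, edgeExp_mem (hS (Finset.mem_insert_self e S)), h2,
      ih (fun x hx => hS (Finset.mem_insert_of_mem hx)), Finset.card_insert_of_notMem heS,
      pow_succ]
    simp only [Finset.union_insert]
    ring

open Classical in
/-- A form of Janson's inequality: if each `S i` has probability exceeding the total probability
of its joint occurrences with the other sets meeting it by at least `δ`, then the probability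
that no `S i` occurs is at most `(1 - δ) ^ |I|`. -/
lemma edgeExp_avoid_le {ι : Type*} (hp0 : 0 ≤ p) (hp1 : p ≤ 1) {δ : ℝ} (hδ0 : 0 ≤ δ) (hδ1 : δ ≤ 1)
    (S : ι → Finset α) (I : Finset ι) (hSE : ∀ i ∈ I, S i ⊆ E)
    (hS : ∀ i ∈ I, ∑ j ∈ I with j ≠ i ∧ ¬ Disjoint (S i) (S j), p ^ (S i ∪ S j).card ≤
      p ^ (S i).card - δ) :
    edgeExp E p (fun A => if ∀ i ∈ I, ¬ S i ⊆ A then 1 else 0) ≤ (1 - δ) ^ I.card := by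
  induction I using Finset.induction_on with
  | empty => simp [edgeExp_const]
  | insert i J hiJ ih =>
    have ihJ := ih (fun j hj => hSE j (Finset.mem_insert_of_mem hj)) fun j hj =>
      le_trans (Finset.sum_le_sum_of_subset_of_nonneg
        (Finset.filter_subset_filter _ (Finset.subset_insert i J))
        fun _ _ _ => by positivity) (hS j (Finset.mem_insert_of_mem hj))
    set N := J.filter fun j => ¬ Disjoint (S i) (S j) with hN
    set g : Finset α → ℝ := fun A => if ∀ j ∈ J, ¬ S j ⊆ A then 1 else 0 with hg
    set r : Finset α → ℝ :=
      fun A => if ∀ j ∈ J, Disjoint (S i) (S j) → ¬ S j ⊆ A then 1 else 0 with hr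
    have hiE : S i ⊆ E := hSE i (Finset.mem_insert_self i J)
    have hsum : ∑ j ∈ N, p ^ (S i ∪ S j).card ≤ p ^ (S i).card - δ := by
      refine le_trans (le_of_eq ?_) (hS i (Finset.mem_insert_self i J))
      refine Finset.sum_congr ?_ fun _ _ => rfl
      ext j
      simp only [hN, Finset.mem_filter, Finset.mem_insert]
      constructor
      · rintro ⟨h, h'⟩
        exact ⟨Or.inr h, fun h'' => hiJ (h'' ▸ h), h'⟩
      · rintro ⟨h | h, h', h''⟩
        · exact absurd h h'
        · exact ⟨h, h''⟩
    have hgr : edgeExp E p g ≤ edgeExp E p r := by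
      refine edgeExp_mono hp0 hp1 fun A _ => ?_
      simp only [hg, hr]
      split_ifs with h1 h2
      · rfl
      · exact absurd (fun j hj _ => h1 j hj) h2
      · norm_num
      · rfl
    have hr0 : 0 ≤ edgeExp E p r := by
      refine edgeExp_nonneg hp0 hp1 fun A => ?_
      simp only [hr]
      split_ifs <;> norm_num
    have hindep : edgeExp E p (fun A => if S i ⊆ A then r A else 0) =
        p ^ (S i).card * edgeExp E p r := by
      rw [edgeExp_subset hiE]
      congr 2
      funext A
      have : ∀ j, Disjoint (S i) (S j) → (S j ⊆ A ∪ S i ↔ S j ⊆ A) := fun j hj =>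
        ⟨fun h => hj.symm.left_le_of_le_sup_right h, fun h => h.trans Finset.subset_union_left⟩
      simp only [hr]
      refine if_congr (forall₃_congr fun j _ hd => by rw [this j hd]) rfl rfl
    have hcorr : ∀ j ∈ N, edgeExp E p (fun A => if S i ∪ S j ⊆ A then r A else 0) ≤
        p ^ (S i ∪ S j).card * edgeExp E p r := by
      intro j hj
      rw [edgeExp_subset (Finset.union_subset hiE
        (hSE j (Finset.mem_insert_of_mem (Finset.mem_filter.1 hj).1)))]
      refine mul_le_mul_of_nonneg_left (edgeExp_mono hp0 hp1 fun A _ => ?_) (by positivity)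
      simp only [hr]
      split_ifs with h1 h2
      · rfl
      · exact absurd (fun l hl hd h => h1 l hl hd (h.trans Finset.subset_union_left)) h2
      · norm_num
      · rfl
    have hlow : edgeExp E p (fun A => if S i ⊆ A then r A else 0) -
        ∑ j ∈ N, edgeExp E p (fun A => if S i ∪ S j ⊆ A then r A else 0) ≤
        edgeExp E p (fun A => if S i ⊆ A then g A else 0) := by
      rw [← edgeExp_sum, ← edgeExp_sub]
      refine edgeExp_mono hp0 hp1 fun A _ => ?_
      have hr0A : 0 ≤ r A := by simp only [hr]; split_ifs <;> norm_num
      have hg0A : 0 ≤ g A := by simp only [hg]; split_ifs <;> norm_num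
      have hnn : ∀ j ∈ N, (0 : ℝ) ≤ if S i ∪ S j ⊆ A then r A else 0 := fun j _ => by
        split_ifs <;> simp [hr0A]
      by_cases hi : S i ⊆ A
      · by_cases hN' : ∃ j ∈ N, S j ⊆ A
        · obtain ⟨j, hj, hjA⟩ := hN'
          have := Finset.single_le_sum hnn hj
          rw [if_pos (Finset.union_subset hi hjA)] at this
          simp only [hi, if_true]
          linarith
        · push Not at hN'
          have : r A ≤ g A := by
            simp only [hg, hr]
            split_ifs with h1 h2
            · rfl
            · refine absurd (fun j hj => ?_) h2
              by_cases hd : Disjoint (S i) (S j)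
              · exact h1 j hj hd
              · exact hN' j (Finset.mem_filter.2 ⟨hj, hd⟩)
            · norm_num
            · rfl
          have := Finset.sum_nonneg hnn
          simp only [hi, if_true]
          linarith
      · have := Finset.sum_nonneg hnn
        simp only [hi, if_false]
        linarith
    have hsplit : edgeExp E p (fun A => if ∀ j ∈ insert i J, ¬ S j ⊆ A then 1 else 0) =
        edgeExp E p g - edgeExp E p (fun A => if S i ⊆ A then g A else 0) := by
      rw [← edgeExp_sub]
      congr 1
      funext A
      simp only [hg, Finset.forall_mem_insert]
      by_cases hi : S i ⊆ A <;> simp [hi]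
    have hsumle := Finset.sum_le_sum hcorr
    rw [← Finset.sum_mul] at hsumle
    have h1 := mul_le_mul_of_nonneg_right hsum hr0
    have h2 := mul_le_mul_of_nonneg_left hgr hδ0
    have h3 := mul_le_mul_of_nonneg_left ihJ (sub_nonneg.2 hδ1)
    rw [hsplit, Finset.card_insert_of_notMem hiJ, pow_succ']
    nlinarith


open Classical in
lemma card_level_succ_mul_le (Q : Finset α → Prop) (hQ : ∀ A B, A ⊆ B → Q B → Q A) (m : ℕ) :
    ((E.powersetCard (m + 1)).filter Q).card * (m + 1) ≤
      ((E.powersetCard m).filter Q).card * (E.card - m) := by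
  refine Finset.card_mul_le_card_mul (fun B A => A ⊆ B) (fun B hB => ?_) fun A hA => ?_
  · simp only [Finset.mem_filter, Finset.mem_powersetCard] at hB
    obtain ⟨⟨hBE, hBc⟩, hQB⟩ := hB
    rw [← hBc, ← Finset.card_image_of_injOn (Finset.erase_injOn B)]
    refine Finset.card_le_card fun A hA => ?_
    obtain ⟨e, he, rfl⟩ := Finset.mem_image.1 hA
    have hsub := Finset.erase_subset e B
    simp only [Finset.bipartiteAbove, Finset.mem_filter, Finset.mem_powersetCard]
    exact ⟨⟨⟨hsub.trans hBE, by rw [Finset.card_erase_of_mem he, hBc]; rfl⟩,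
      hQ _ _ hsub hQB⟩, hsub⟩
  · simp only [Finset.mem_filter, Finset.mem_powersetCard] at hA
    obtain ⟨⟨hAE, hAc⟩, -⟩ := hA
    rw [← hAc, ← Finset.card_sdiff_of_subset hAE]
    refine le_trans (Finset.card_le_card fun B hB => ?_)
      (Finset.card_image_le (s := E \ A) (f := fun e => insert e A))
    simp only [Finset.bipartiteBelow, Finset.mem_filter, Finset.mem_powersetCard] at hB
    obtain ⟨⟨⟨hBE, hBc⟩, -⟩, hAB⟩ := hB
    obtain ⟨e, he⟩ := Finset.card_eq_one.1
      (show (B \ A).card = 1 by rw [Finset.card_sdiff_of_subset hAB]; omega)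
    have heB : e ∈ B \ A := he ▸ Finset.mem_singleton_self e
    rw [Finset.mem_sdiff] at heB
    refine Finset.mem_image.2 ⟨e, Finset.mem_sdiff.2 ⟨hBE heB.1, heB.2⟩, ?_⟩
    rw [Finset.insert_eq, ← he, Finset.sdiff_union_of_subset hAB]

open Classical in
lemma uniformProb_eq (M : ℕ) (Q : Finset α → Prop) :
    uniformProb E M Q = ((E.powersetCard M).filter Q).card / (E.card.choose M : ℝ) := by
  unfold uniformProb
  rw [← Finset.filter_filter, ← Finset.powersetCard_eq_filter, Finset.card_powersetCard]

lemma uniformProb_antitone {Q : Finset α → Prop} (hQ : ∀ A B, A ⊆ B → Q B → Q A) {m M : ℕ}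
    (hm : m ≤ M) (hM : M ≤ E.card) : uniformProb E M Q ≤ uniformProb E m Q := by
  classical
  induction M, hm using Nat.le_induction with
  | base => rfl
  | succ M _ ih =>
    refine le_trans ?_ (ih (by omega))
    have h1 : (0 : ℝ) < E.card.choose M := by exact_mod_cast Nat.choose_pos (by omega)
    have h2 : (0 : ℝ) < E.card.choose (M + 1) := by exact_mod_cast Nat.choose_pos hM
    rw [uniformProb_eq, uniformProb_eq, div_le_div_iff₀ h2 h1]
    have h3 := card_level_succ_mul_le (E := E) Q hQ M
    have h4 := Nat.choose_succ_right_eq E.card M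
    have h5 : 0 < E.card - M := by omega
    norm_cast
    refine Nat.le_of_mul_le_mul_right ?_ (Nat.mul_pos h5 (Nat.succ_pos M))
    calc _ = (((E.powersetCard (M + 1)).filter Q).card * (M + 1)) *
          (E.card.choose M * (E.card - M)) := by rw [Nat.succ_eq_add_one]; ring
      _ ≤ (((E.powersetCard M).filter Q).card * (E.card - M)) *
          (E.card.choose M * (E.card - M)) := Nat.mul_le_mul_right _ h3
      _ = _ := by rw [← h4, Nat.succ_eq_add_one]; ring

lemma half_le_edgeExp_card_le (hp0 : 0 ≤ p) (hp1 : p ≤ 1) {M : ℕ}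
    (hM : 2 * (p * E.card) ≤ M + 1) :
    1 / 2 ≤ edgeExp E p (fun A => if A.card ≤ M then 1 else 0) := by
  have hmean : edgeExp E p (fun A => (A.card : ℝ)) = p * E.card := by
    have : edgeExp E p (fun A => (A.card : ℝ)) =
        edgeExp E p (fun A => ∑ e ∈ E, if e ∈ A then (1 : ℝ) else 0) := by
      unfold edgeExp
      refine Finset.sum_congr rfl fun A hA => ?_
      congr 1
      dsimp only
      rw [Finset.sum_ite_mem, Finset.inter_eq_right.2 (Finset.mem_powerset.1 hA)]
      simp
    rw [this, edgeExp_sum, Finset.sum_congr rfl fun e he => edgeExp_mem he fun _ => 1]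
    simp [edgeExp_const, mul_comm]
  have hM0 : (0 : ℝ) < M + 1 := by positivity
  have h : edgeExp E p (fun A => 1 - (1 / (M + 1 : ℝ)) * A.card) ≤
      edgeExp E p (fun A => if A.card ≤ M then 1 else 0) := by
    refine edgeExp_mono hp0 hp1 fun A _ => ?_
    split_ifs with h
    · have : 0 ≤ 1 / (M + 1 : ℝ) * A.card := by positivity
      linarith
    · have : (M + 1 : ℝ) ≤ A.card := by exact_mod_cast not_le.1 h
      rw [sub_nonpos, one_div, inv_mul_eq_div, le_div_iff₀ hM0]
      linarith
  refine le_trans ?_ h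
  rw [edgeExp_sub, edgeExp_const, edgeExp_mul_left, hmean, one_div_mul_eq_div]
  have : p * E.card / (M + 1 : ℝ) ≤ 1 / 2 := by
    rw [div_le_iff₀ hM0]
    linarith
  linarith

open Classical in
/-- For decreasing properties, the uniform model is dominated by a sparser binomial model. -/
lemma uniformProb_le_two_mul_edgeExp (hp0 : 0 ≤ p) (hp1 : p ≤ 1) {M : ℕ}
    (hM : 2 * (p * E.card) ≤ M + 1) {Q : Finset α → Prop} (hQ : ∀ A B, A ⊆ B → Q B → Q A) :
    uniformProb E M Q ≤ 2 * edgeExp E p (fun A => if Q A then 1 else 0) := by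
  have hq0 : 0 ≤ edgeExp E p (fun A => if Q A then 1 else 0) := by
    refine edgeExp_nonneg hp0 hp1 fun A => ?_
    split_ifs <;> norm_num
  by_cases hME : M ≤ E.card
  swap
  · rw [uniformProb_eq, Nat.choose_eq_zero_of_lt (not_le.1 hME)]
    simpa using hq0
  have hu0 : 0 ≤ uniformProb E M Q := by
    rw [uniformProb_eq]
    positivity
  have key : uniformProb E M Q * edgeExp E p (fun A => if A.card ≤ M then 1 else 0) ≤
      edgeExp E p (fun A => if Q A then 1 else 0) := by
    rw [← edgeExp_mul_left]
    unfold edgeExp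
    rw [Finset.sum_powerset, Finset.sum_powerset]
    refine Finset.sum_le_sum fun m hm => ?_
    have hp1' : 0 ≤ 1 - p := by linarith
    have hlev : ∀ f : Finset α → ℝ, ∑ A ∈ E.powersetCard m,
        p ^ A.card * (1 - p) ^ (E.card - A.card) * f A =
        p ^ m * (1 - p) ^ (E.card - m) * ∑ A ∈ E.powersetCard m, f A := by
      intro f
      rw [Finset.mul_sum]
      exact Finset.sum_congr rfl fun A hA => by rw [(Finset.mem_powersetCard.1 hA).2]
    rw [hlev, hlev]
    refine mul_le_mul_of_nonneg_left ?_ (by positivity)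
    rw [Finset.sum_boole]
    have hmE : m ≤ E.card := Nat.lt_succ_iff.1 (Finset.mem_range.1 hm)
    by_cases hmM : m ≤ M
    · have hc : (0 : ℝ) < E.card.choose m := by exact_mod_cast Nat.choose_pos hmE
      have h := uniformProb_antitone (E := E) hQ hmM hME
      rw [uniformProb_eq m, le_div_iff₀ hc] at h
      refine le_trans (le_of_eq ?_) h
      rw [Finset.sum_congr rfl (g := fun _ => uniformProb E M Q) fun A hA => by
        rw [(Finset.mem_powersetCard.1 hA).2, if_pos hmM, mul_one]]
      simp [mul_comm]
    · rw [Finset.sum_congr rfl (g := fun _ => 0) fun A hA => by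
        rw [(Finset.mem_powersetCard.1 hA).2, if_neg hmM, mul_zero]]
      simp
  have h := mul_le_mul_of_nonneg_left (half_le_edgeExp_card_le hp0 hp1 hM) hu0
  linarith

end edgeExp

section transversal
variable {k m n : ℕ}

/-- The vertex of the `i`-th class of the Turán graph whose index within the class is `f i`. -/
def partVertex (h : k * m ≤ n) (f : Fin k → Fin m) (i : Fin k) : Fin n :=
  ⟨k * (f i).val + i.val, by
    have h1 : k * ((f i).val + 1) ≤ k * m := Nat.mul_le_mul_left k (f i).2
    have h2 := i.2
    rw [Nat.mul_add, Nat.mul_one] at h1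
    omega⟩

lemma partVertex_mod (h : k * m ≤ n) (f : Fin k → Fin m) (i : Fin k) :
    (partVertex h f i).val % k = i.val := by
  simp [partVertex, Nat.mod_eq_of_lt i.2]

lemma partVertex_eq_iff (h : k * m ≤ n) (f g : Fin k → Fin m) (i j : Fin k) :
    partVertex h f i = partVertex h g j ↔ i = j ∧ f i = g i := by
  constructor
  · intro hij
    obtain rfl : i = j := by
      apply Fin.ext
      rw [← partVertex_mod h f i, hij, partVertex_mod]
    refine ⟨rfl, Fin.ext ?_⟩
    have hk : 0 < k := i.pos
    have := congrArg Fin.val hij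
    simp only [partVertex, Nat.add_right_cancel_iff] at this
    exact Nat.eq_of_mul_eq_mul_left hk this
  · rintro ⟨rfl, hf⟩
    simp [partVertex, hf]

lemma partVertex_injective (h : k * m ≤ n) (f : Fin k → Fin m) :
    Function.Injective (partVertex h f) := fun i j hij =>
  ((partVertex_eq_iff h f f i j).1 hij).1

/-- The edges of the good copy of `K_k` on the vertices `partVertex h f i`. -/
def transversalEdges (h : k * m ≤ n) (f : Fin k → Fin m) : Finset (Sym2 (Fin n)) :=
  ((Finset.univ.offDiag : Finset (Fin k × Fin k)).image fun e => s(e.1, e.2)).image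
    (Sym2.map (partVertex h f))

lemma mem_transversalEdges {h : k * m ≤ n} {f : Fin k → Fin m} {e : Sym2 (Fin n)} :
    e ∈ transversalEdges h f ↔
      ∃ i j : Fin k, i ≠ j ∧ s(partVertex h f i, partVertex h f j) = e := by
  simp [transversalEdges]

lemma card_image_offDiag_mk (s : Finset (Fin k)) :
    (s.offDiag.image fun e => s(e.1, e.2)).card = s.card.choose 2 :=
  Sym2.card_image_offDiag s

lemma card_transversalEdges (h : k * m ≤ n) (f : Fin k → Fin m) :
    (transversalEdges h f).card = k.choose 2 := by
  rw [transversalEdges, Finset.card_image_of_injective _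
    (Sym2.map.injective (partVertex_injective h f)), card_image_offDiag_mk]
  simp

lemma transversalEdges_subset_turanEdges (h : k * m ≤ n) (f : Fin k → Fin m) :
    transversalEdges h f ⊆ turanEdges n k := by
  intro e he
  obtain ⟨i, j, hij, rfl⟩ := mem_transversalEdges.1 he
  simp [turanEdges, partVertex_mod, Fin.val_inj, hij]

lemma goodCopy_of_transversalEdges_subset (h : k * m ≤ n) (f : Fin k → Fin m)
    {A : Finset (Sym2 (Fin n))} (hA : transversalEdges h f ⊆ A) : GoodCopy n k A := by
  refine ⟨partVertex h f, partVertex_injective h f, fun i j hij => ?_, fun i j hij =>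
    hA (mem_transversalEdges.2 ⟨i, j, hij, rfl⟩)⟩
  rwa [partVertex_mod, partVertex_mod, Ne, Fin.val_inj]

/-- The classes in which the choices `f` and `g` agree. -/
def agreeSet (f g : Fin k → Fin m) : Finset (Fin k) := Finset.univ.filter fun i => f i = g i

lemma inter_transversalEdges_subset (h : k * m ≤ n) (f g : Fin k → Fin m) :
    transversalEdges h f ∩ transversalEdges h g ⊆
      ((agreeSet f g).offDiag.image fun e => s(e.1, e.2)).image (Sym2.map (partVertex h f)) := by
  intro e he
  rw [Finset.mem_inter] at he
  obtain ⟨i, j, hij, rfl⟩ := mem_transversalEdges.1 he.1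
  obtain ⟨i', j', hij', he'⟩ := mem_transversalEdges.1 he.2
  have hi : f i = g i ∧ f j = g j := by
    rw [Sym2.eq_iff] at he'
    rcases he' with ⟨h1, h2⟩ | ⟨h1, h2⟩
    · exact ⟨((partVertex_eq_iff h f g i i').1 h1.symm).2,
        ((partVertex_eq_iff h f g j j').1 h2.symm).2⟩
    · exact ⟨((partVertex_eq_iff h f g i j').1 h2.symm).2,
        ((partVertex_eq_iff h f g j i').1 h1.symm).2⟩
  refine Finset.mem_image.2 ⟨s(i, j), Finset.mem_image.2 ⟨(i, j), ?_, rfl⟩, rfl⟩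
  simp [agreeSet, hi, hij]

lemma card_inter_transversalEdges_le (h : k * m ≤ n) (f g : Fin k → Fin m) :
    (transversalEdges h f ∩ transversalEdges h g).card ≤ (agreeSet f g).card.choose 2 :=
  (Finset.card_le_card (inter_transversalEdges_subset h f g)).trans
    (Finset.card_image_le.trans (card_image_offDiag_mk _).le)

lemma card_agreeSet_lt {f g : Fin k → Fin m} (hfg : g ≠ f) : (agreeSet f g).card < k := by
  have : agreeSet f g ≠ Finset.univ := fun h => hfg <| funext fun i => by
    have : i ∈ agreeSet f g := h ▸ Finset.mem_univ i
    exact (Finset.mem_filter.1 this).2.symm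
  simpa using Finset.card_lt_card (Finset.ssubset_univ_iff.2 this)

lemma two_le_card_agreeSet (h : k * m ≤ n) {f g : Fin k → Fin m}
    (hd : ¬ Disjoint (transversalEdges h f) (transversalEdges h g)) :
    2 ≤ (agreeSet f g).card := by
  by_contra! hlt
  have := card_inter_transversalEdges_le h f g
  rw [Nat.choose_eq_zero_of_lt hlt, Nat.le_zero, Finset.card_eq_zero] at this
  exact hd (Finset.disjoint_iff_inter_eq_empty.2 this)

lemma card_agreeSet_eq_le (f : Fin k → Fin m) (T : Finset (Fin k)) :
    (Finset.univ.filter fun g : Fin k → Fin m => agreeSet f g = T).card ≤ m ^ (k - T.card) := by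
  calc _ ≤ (Fintype.piFinset fun i =>
        if i ∈ T then {f i} else (Finset.univ : Finset (Fin m))).card := by
        refine Finset.card_le_card fun g hg => Fintype.mem_piFinset.2 fun i => ?_
        obtain rfl := (Finset.mem_filter.1 hg).2
        split_ifs with hi
        · simp [(Finset.mem_filter.1 hi).2]
        · simp
    _ = ∏ i : Fin k, if i ∈ T then 1 else m := by
        rw [Fintype.card_piFinset]
        refine Finset.prod_congr rfl fun i _ => ?_
        split_ifs <;> simp
    _ = m ^ (k - T.card) := by
        rw [Finset.prod_ite, Finset.prod_const_one, one_mul, Finset.prod_const]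
        congr 1
        rw [← Finset.compl_filter, Finset.card_compl]
        simp

/-- The copies of `K_s` with `2 ≤ s < k` are at least as numerous as the copies of `K_k`
in the density regime `p = ε n^{-2/(k+1)}`, where `n = x^(k+1)`. -/
lemma overlap_weight_le {s : ℕ} {x ε : ℝ} (hx : 1 ≤ x) (hε0 : 0 ≤ ε) (hε1 : ε ≤ 1)
    (hm : (m : ℝ) ≤ x ^ (k + 1)) (hs : 2 ≤ s) (hsk : s < k) :
    (m : ℝ) ^ (k - s) * (ε * (x ^ 2)⁻¹) ^ (2 * k.choose 2 - s.choose 2) ≤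
      ε * (ε * (x ^ 2)⁻¹) ^ k.choose 2 := by
  obtain ⟨d, hd⟩ : ∃ d, k.choose 2 = s.choose 2 + d :=
    Nat.exists_eq_add_of_le (Nat.choose_le_choose 2 hsk.le)
  obtain ⟨t, rfl⟩ : ∃ t, k = s + t := Nat.exists_eq_add_of_le hsk.le
  have ht : 1 ≤ t := by omega
  have hexp : (s + t + 1) * t ≤ 2 * d := by
    have h1 : (((s + t).choose 2 : ℕ) : ℝ) = s.choose 2 + d := by exact_mod_cast hd
    rw [Nat.cast_choose_two, Nat.cast_choose_two] at h1
    push_cast at h1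
    have h2 : (2 : ℝ) ≤ s := by exact_mod_cast hs
    have h3 : (0 : ℝ) ≤ t * (s - 2) := mul_nonneg (by positivity) (by linarith)
    have : ((s + t + 1) * t : ℝ) ≤ 2 * d := by nlinarith
    exact_mod_cast this
  have hd1 : 1 ≤ d := by
    have : 1 * 1 ≤ (s + t + 1) * t := Nat.mul_le_mul (by omega) ht
    omega
  have hx0 : 0 < x := by linarith
  rw [show 2 * (s + t).choose 2 - s.choose 2 = d + (s + t).choose 2 by omega, pow_add, ← mul_assoc,
    Nat.add_sub_cancel_left]
  refine mul_le_mul_of_nonneg_right ?_ (by positivity)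
  calc (m : ℝ) ^ t * (ε * (x ^ 2)⁻¹) ^ d
      ≤ (x ^ (s + t + 1)) ^ t * (ε * (x ^ 2)⁻¹) ^ d := by gcongr
    _ = x ^ ((s + t + 1) * t) * (ε ^ d * (x ^ (2 * d))⁻¹) := by
        rw [mul_pow, inv_pow, ← pow_mul, ← pow_mul]
    _ ≤ x ^ (2 * d) * (ε ^ d * (x ^ (2 * d))⁻¹) := by
        gcongr
    _ = ε ^ d := by field_simp
    _ ≤ ε := pow_le_of_le_one hε0 hε1 (by omega)

open Classical in
lemma sum_transversal_overlap_le (h : k * m ≤ n) {x ε : ℝ} (hx : 1 ≤ x) (hε0 : 0 ≤ ε)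
    (hε : 2 ^ k * ε ≤ 1 / 2) (hm : (m : ℝ) ≤ x ^ (k + 1)) (f : Fin k → Fin m) :
    ∑ g : Fin k → Fin m with g ≠ f ∧ ¬ Disjoint (transversalEdges h f) (transversalEdges h g),
      (ε * (x ^ 2)⁻¹) ^ (transversalEdges h f ∪ transversalEdges h g).card ≤
      (ε * (x ^ 2)⁻¹) ^ k.choose 2 / 2 := by
  set p := ε * (x ^ 2)⁻¹ with hp
  have hp0 : 0 ≤ p := by positivity
  have hε1 : ε ≤ 1 := by
    have : (1 : ℝ) ≤ 2 ^ k := one_le_pow₀ (by norm_num)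
    nlinarith
  have hp1 : p ≤ 1 := mul_le_one₀ hε1 (by positivity) (inv_le_one_of_one_le₀ (one_le_pow₀ hx))
  set G := Finset.univ.filter fun g : Fin k → Fin m =>
    g ≠ f ∧ ¬ Disjoint (transversalEdges h f) (transversalEdges h g) with hG
  have hterm : ∀ g ∈ G, p ^ (transversalEdges h f ∪ transversalEdges h g).card ≤
      p ^ (2 * k.choose 2 - (agreeSet f g).card.choose 2) := by
    intro g _
    refine pow_le_pow_of_le_one hp0 hp1 ?_
    have h1 := Finset.card_union_add_card_inter (transversalEdges h f) (transversalEdges h g)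
    have h2 := card_inter_transversalEdges_le h f g
    rw [card_transversalEdges, card_transversalEdges] at h1
    omega
  have hfib : ∀ T : Finset (Fin k), ∑ g ∈ G with agreeSet f g = T,
      p ^ (2 * k.choose 2 - (agreeSet f g).card.choose 2) ≤ ε * p ^ k.choose 2 := by
    intro T
    rcases (G.filter fun g => agreeSet f g = T).eq_empty_or_nonempty with hE | ⟨g₀, hg₀⟩
    · rw [hE, Finset.sum_empty]
      positivity
    · obtain ⟨hg₀G, rfl⟩ := Finset.mem_filter.1 hg₀
      obtain ⟨-, hne, hd⟩ := Finset.mem_filter.1 hg₀G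
      refine le_trans ?_
        (overlap_weight_le hx hε0 hε1 hm (two_le_card_agreeSet h hd) (card_agreeSet_lt hne))
      rw [Finset.sum_congr rfl (g := fun _ => p ^ (2 * k.choose 2 - (agreeSet f g₀).card.choose 2))
        fun g hg => by rw [(Finset.mem_filter.1 hg).2], Finset.sum_const, nsmul_eq_mul]
      refine mul_le_mul_of_nonneg_right ?_ (by positivity)
      refine le_trans ?_ (Nat.cast_le.2 (card_agreeSet_eq_le f (agreeSet f g₀)) |>.trans
        (Nat.cast_pow _ _).le)
      exact_mod_cast Finset.card_le_card (Finset.filter_subset_filter _ (Finset.subset_univ G))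
  calc _ ≤ ∑ g ∈ G, p ^ (2 * k.choose 2 - (agreeSet f g).card.choose 2) := Finset.sum_le_sum hterm
    _ = ∑ T : Finset (Fin k), ∑ g ∈ G with agreeSet f g = T,
        p ^ (2 * k.choose 2 - (agreeSet f g).card.choose 2) :=
      (Finset.sum_fiberwise G (agreeSet f) _).symm
    _ ≤ ∑ _T : Finset (Fin k), ε * p ^ k.choose 2 := Finset.sum_le_sum fun T _ => hfib T
    _ = (2 ^ k * ε) * p ^ k.choose 2 := by simp [mul_assoc]
    _ ≤ 1 / 2 * p ^ k.choose 2 := mul_le_mul_of_nonneg_right hε (by positivity)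
    _ = p ^ k.choose 2 / 2 := by ring

open Classical in
lemma edgeExp_not_goodCopy_le (h : k * m ≤ n) {Q : Finset (Sym2 (Fin n)) → Prop}
    (hQ : ∀ A, Q A → ¬ GoodCopy n k A) {x ε : ℝ} (hx : 1 ≤ x) (hε0 : 0 ≤ ε)
    (hε : 2 ^ k * ε ≤ 1 / 2) (hm : (m : ℝ) ≤ x ^ (k + 1)) :
    edgeExp (turanEdges n k) (ε * (x ^ 2)⁻¹) (fun A => if Q A then 1 else 0) ≤
      Real.exp (-((ε * (x ^ 2)⁻¹) ^ k.choose 2 / 2 * m ^ k)) := by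
  set p := ε * (x ^ 2)⁻¹ with hp
  have hp0 : 0 ≤ p := by positivity
  have hε1 : ε ≤ 1 := by
    have : (1 : ℝ) ≤ 2 ^ k := one_le_pow₀ (by norm_num)
    nlinarith
  have hp1 : p ≤ 1 := mul_le_one₀ hε1 (by positivity) (inv_le_one_of_one_le₀ (one_le_pow₀ hx))
  have hδ : p ^ k.choose 2 ≤ 1 := pow_le_one₀ hp0 hp1
  have hδ0 : 0 ≤ p ^ k.choose 2 := by positivity
  have hJ := edgeExp_avoid_le (E := turanEdges n k) hp0 hp1 (δ := p ^ k.choose 2 / 2)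
    (by positivity) (by linarith) (transversalEdges (m := m) h) Finset.univ
    (fun f _ => transversalEdges_subset_turanEdges h f) fun f _ => by
      rw [card_transversalEdges]
      rw [sub_half]
      convert sum_transversal_overlap_le h hx hε0 hε hm f
  refine le_trans (edgeExp_mono hp0 hp1 fun A _ => ?_) (hJ.trans ?_)
  · split_ifs with h1 h2
    · rfl
    · exact absurd (fun f _ hf => hQ A h1 (goodCopy_of_transversalEdges_subset h f hf)) h2
    · norm_num
    · rfl
  · have h1 : 1 - p ^ k.choose 2 / 2 ≤ Real.exp (-(p ^ k.choose 2 / 2)) := by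
      have := Real.add_one_le_exp (-(p ^ k.choose 2 / 2))
      linarith
    refine (pow_le_pow_left₀ (by linarith) h1 _).trans (le_of_eq ?_)
    rw [← Real.exp_nat_mul]
    simp [mul_comm]

end transversal

lemma GoodCopy.mono {n k : ℕ} {A B : Finset (Sym2 (Fin n))} (hAB : A ⊆ B) (h : GoodCopy n k A) :
    GoodCopy n k B := by
  obtain ⟨f, hf, hf', hA⟩ := h
  exact ⟨f, hf, hf', fun i j hij => hAB (hA i j hij)⟩

lemma card_turanEdges_le (n k : ℕ) : (turanEdges n k).card ≤ n ^ 2 := by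
  have h : Fintype.card (Sym2 (Fin n)) ≤ Fintype.card (Fin n × Fin n) :=
    Fintype.card_le_of_surjective (fun e => s(e.1, e.2)) fun e =>
      e.ind fun a b => ⟨(a, b), rfl⟩
  refine (Finset.card_le_univ _).trans (h.trans (le_of_eq ?_))
  simp [sq]

lemma uniformProb_not_goodCopy_le {n k M : ℕ} {x ε : ℝ} (hk : 0 < k) (hkn : k ≤ n) (hε0 : 0 ≤ ε)
    (hε : 2 ^ k * ε ≤ 1 / 2) (hx : 1 ≤ x) (hxn : x ^ (k + 1) = n)
    (hM : (M : ℝ) ≤ x ^ (2 * k)) (hM' : x ^ (2 * k) ≤ M + 1) :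
    uniformProb (turanEdges n k) M (fun A => ¬ GoodCopy n k A) ≤
      2 * Real.exp (-(ε ^ k.choose 2 / (2 * (2 * k) ^ k) * M)) := by
  have hx0 : 0 < x := by linarith
  have hε1 : 2 * ε ≤ 1 := by
    have : (1 : ℝ) ≤ 2 ^ k := one_le_pow₀ (by norm_num)
    nlinarith
  have hp1 : ε * (x ^ 2)⁻¹ ≤ 1 :=
    mul_le_one₀ (by linarith) (by positivity) (inv_le_one_of_one_le₀ (one_le_pow₀ hx))
  have hsize : 2 * (ε * (x ^ 2)⁻¹ * (turanEdges n k).card) ≤ M + 1 := by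
    have h1 : ((turanEdges n k).card : ℝ) ≤ (x ^ (k + 1)) ^ 2 := by
      rw [hxn]
      exact_mod_cast card_turanEdges_le n k
    have h2 : (x ^ (k + 1)) ^ 2 = x ^ (2 * k) * x ^ 2 := by ring
    calc _ = (2 * ε) * ((x ^ 2)⁻¹ * (turanEdges n k).card) := by ring
      _ ≤ 1 * ((x ^ 2)⁻¹ * (x ^ (2 * k) * x ^ 2)) := by
        rw [← h2]
        gcongr
      _ = x ^ (2 * k) := by field_simp
      _ ≤ M + 1 := hM'
  refine (uniformProb_le_two_mul_edgeExp (by positivity) hp1 hsize fun A B hAB hB hA =>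
    hB (hA.mono hAB)).trans ?_
  have hm : ((n / k : ℕ) : ℝ) ≤ x ^ (k + 1) := by
    rw [hxn]
    exact_mod_cast Nat.div_le_self n k
  refine mul_le_mul_of_nonneg_left
    ((edgeExp_not_goodCopy_le (Nat.mul_div_le n k) (fun _ => id) hx hε0 hε hm).trans ?_) (by norm_num)
  rw [Real.exp_le_exp, neg_le_neg_iff]
  have hmlow : x ^ (k + 1) / (2 * k) ≤ ((n / k : ℕ) : ℝ) := by
    rw [hxn, div_le_iff₀ (by positivity)]
    have h1 : n < k * (n / k) + k := Nat.lt_mul_div_succ n hk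
    have h2 : k * 1 ≤ k * (n / k) := Nat.mul_le_mul_left k (Nat.div_pos hkn hk)
    have h3 : n ≤ n / k * (2 * k) := by nlinarith
    exact_mod_cast h3
  have hchoose : 2 * k.choose 2 + 2 * k = (k + 1) * k := by
    have h1 : (2 * k.choose 2 + 2 * k : ℝ) = (k + 1) * k := by
      rw [Nat.cast_choose_two]
      ring
    exact_mod_cast h1
  calc ε ^ k.choose 2 / (2 * (2 * k) ^ k) * M
      ≤ ε ^ k.choose 2 / (2 * (2 * k) ^ k) * x ^ (2 * k) := by gcongr
    _ = ε ^ k.choose 2 * (x ^ (2 * k.choose 2))⁻¹ / 2 * (x ^ ((k + 1) * k) / (2 * k) ^ k) := by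
      rw [← hchoose, pow_add]
      field_simp
    _ = (ε * (x ^ 2)⁻¹) ^ k.choose 2 / 2 * (x ^ (k + 1) / (2 * k)) ^ k := by
      rw [mul_pow ε, inv_pow, ← pow_mul, div_pow, ← pow_mul]
    _ ≤ _ := by gcongr

/-- Probability that `G(T_{n,k}, M)` has no good copy of `K_k` is at most
`exp(-c₁' M)` for `M = ⌊n^{2-2/(k+1)}⌋`. -/
theorem no_good_copy_prob_uniform (k : ℕ) (hk : 3 ≤ k) :
    ∃ c₁' : ℝ, 0 < c₁' ∧ ∃ n₀ : ℕ, ∀ n : ℕ, n₀ ≤ n →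
      uniformProb (turanEdges n k) (⌊(n : ℝ) ^ (2 - 2 / (k + 1 : ℝ))⌋₊)
          (fun A => ¬ GoodCopy n k A) ≤
        Real.exp (-(c₁' * (⌊(n : ℝ) ^ (2 - 2 / (k + 1 : ℝ))⌋₊ : ℝ))) := by
  set ε : ℝ := 1 / (2 * 2 ^ k) with hε
  have hε0 : 0 < ε := by positivity
  have hk0 : (0 : ℝ) < k := by exact_mod_cast (by omega : 0 < k)
  set c : ℝ := ε ^ k.choose 2 / (2 * (2 * k) ^ k) with hc
  have hc0 : 0 < c := by positivity
  have hexp : 0 < 2 - 2 / (k + 1 : ℝ) := by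
    rw [sub_pos, div_lt_iff₀ (by positivity)]
    linarith
  have hlim : Filter.Tendsto (fun n : ℕ => (⌊(n : ℝ) ^ (2 - 2 / (k + 1 : ℝ))⌋₊ : ℝ))
      Filter.atTop Filter.atTop :=
    tendsto_natCast_atTop_atTop.comp (tendsto_nat_floor_atTop.comp
      ((tendsto_rpow_atTop hexp).comp tendsto_natCast_atTop_atTop))
  obtain ⟨n₁, hn₁⟩ := Filter.eventually_atTop.1 (hlim.eventually_ge_atTop (2 * Real.log 2 / c))
  refine ⟨c / 2, by positivity, max n₁ k, fun n hn => ?_⟩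
  have hkn : k ≤ n := le_of_max_le_right hn
  have hn1 : (1 : ℝ) ≤ n := by exact_mod_cast (by omega : 1 ≤ n)
  have hM := hn₁ n (le_of_max_le_left hn)
  set M := ⌊(n : ℝ) ^ (2 - 2 / (k + 1 : ℝ))⌋₊
  set x : ℝ := (n : ℝ) ^ (1 / (k + 1 : ℝ)) with hx
  have hxn : x ^ (k + 1) = n := by
    rw [hx, ← Real.rpow_natCast, ← Real.rpow_mul (by linarith)]
    push_cast
    rw [one_div_mul_cancel (by positivity), Real.rpow_one]
  have hxM : x ^ (2 * k) = (n : ℝ) ^ (2 - 2 / (k + 1 : ℝ)) := by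
    rw [hx, ← Real.rpow_natCast, ← Real.rpow_mul (by linarith)]
    congr 1
    push_cast
    field_simp
    ring
  have hbound := uniformProb_not_goodCopy_le (M := M) (by omega) hkn hε0.le
    (by rw [hε]; field_simp; norm_num) (Real.one_le_rpow hn1 (by positivity)) hxn
    (by rw [hxM]; exact Nat.floor_le (by positivity))
    (by rw [hxM]; exact (Nat.lt_floor_add_one _).le)
  refine hbound.trans ?_
  rw [div_le_iff₀ hc0] at hM
  nth_rewrite 1 [← Real.exp_log (show (0 : ℝ) < 2 by norm_num)]
  rw [← Real.exp_add, Real.exp_le_exp]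
  linarith

end TournamentGame
end

section
/- Breaker has a strategy to prevent Maker from creating a cyclic (directed) triangle in the unbiased T_C-tournament game played on the edge set of the 4-wheel W₄, even if Maker is allowed to claim and orient two edges in her first turn (and one edge per turn thereafter), provided that not both of Maker's two initial edges are incident with the center vertex of W₄. -/
namespace TournamentGame

variable {V : Type*} [DecidableEq V]

/-- The edge set of the 4-wheel on `Fin 5`, with center `4`. -/
def W4edges : Finset (Sym2 (Fin 5)) :=
  {s((0 : Fin 5), (1 : Fin 5)), s((1 : Fin 5), (2 : Fin 5)), s((2 : Fin 5), (3 : Fin 5)),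
   s((3 : Fin 5), (0 : Fin 5)), s((0 : Fin 5), (4 : Fin 5)), s((1 : Fin 5), (4 : Fin 5)),
   s((2 : Fin 5), (4 : Fin 5)), s((3 : Fin 5), (4 : Fin 5))}

/-- If Breaker can answer every legal move of Maker, then he blocks. -/
theorem OBreakerBlock.of_forall_turn {X : Finset (Sym2 V)} {F : Finset (V × V) → Prop} {b : ℕ}
    {M : Finset (V × V)} {B : Finset (Sym2 V)} (hF : ¬ F M)
    (h : ∀ x y : V, s(x, y) ∈ X → s(x, y) ∉ undirect M ∪ B →
      OBreakerTurn X F b (insert (x, y) M) B) :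
    OBreakerBlock X F b M B := by
  have h' : ∀ x y : V, ∃ B' : Finset (Sym2 V), s(x, y) ∈ X → s(x, y) ∉ undirect M ∪ B →
      B' ⊆ X \ (insert s(x, y) (undirect M) ∪ B) ∧
      B'.card = min b (X \ (insert s(x, y) (undirect M) ∪ B)).card ∧
      OBreakerBlock X F b (insert (x, y) M) (B ∪ B') := by
    intro x y
    by_cases hX : s(x, y) ∈ X ∧ s(x, y) ∉ undirect M ∪ B
    · obtain ⟨-, B', hB'⟩ := h x y hX.1 hX.2
      exact ⟨B', fun _ _ => by simpa [undirect, Finset.image_insert] using hB'⟩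
    · exact ⟨∅, fun h₁ h₂ => (hX ⟨h₁, h₂⟩).elim⟩
  choose resp hresp using h'
  exact .step M B hF resp (fun x y h₁ h₂ => (hresp x y h₁ h₂).1)
    (fun x y h₁ h₂ => (hresp x y h₁ h₂).2.1) (fun x y h₁ h₂ => (hresp x y h₁ h₂).2.2)

/-- Adding the arc `e` to the arcs in `M` closes a directed triangle through `e`. -/
def closesCyclic (M : List (V × V)) (e : V × V) : Bool :=
  M.any fun q => decide (q.1 = e.2) && decide ((q.2, e.1) ∈ M)

/-- Bounded game search with Maker to move: her arcs are `M`, and `L` lists the free edges,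
each with an arbitrary orientation. The first argument bounds the number of rounds left. -/
def blocks : ℕ → List (V × V) → List (V × V) → Bool
  | 0, _, L => L.isEmpty
  | n + 1, M, L => L.all fun e => [e, e.swap].all fun e' =>
      !closesCyclic M e' &&
        ((L.erase e).isEmpty || (L.erase e).any fun g => blocks n (e' :: M) ((L.erase e).erase g))

/-- Breaker, to move right after Maker has added the arc `e` to `M`, survives:
`R` lists the free edges. -/
def answers (n : ℕ) (M : List (V × V)) (e : V × V) (R : List (V × V)) : Bool :=
  !closesCyclic M e && (R.isEmpty || R.any fun g => blocks n (e :: M) (R.erase g))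

theorem not_hasCyclicTriangle_cons {M : List (V × V)} {e : V × V}
    (hM : ¬ HasCyclicTriangle M.toFinset) (he : closesCyclic M e = false) :
    ¬ HasCyclicTriangle (e :: M).toFinset := by
  have key : ∀ x y z : V, e = (x, y) → (y, z) ∈ M → (z, x) ∈ M → False := by
    rintro x y z rfl h₁ h₂
    simp only [closesCyclic, List.any_eq_false, Bool.and_eq_true, decide_eq_true_eq] at he
    exact he _ h₁ ⟨rfl, h₂⟩
  rintro ⟨x, y, z, hxy, hyz, hxz, h₁, h₂, h₃⟩
  simp only [List.toFinset_cons, Finset.mem_insert, List.mem_toFinset] at h₁ h₂ h₃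
  rcases h₁ with h₁ | h₁
  · exact key x y z h₁.symm (h₂.resolve_left (by grind)) (h₃.resolve_left (by grind))
  rcases h₂ with h₂ | h₂
  · exact key y z x h₂.symm (h₃.resolve_left (by grind)) h₁
  rcases h₃ with h₃ | h₃
  · exact key z x y h₃.symm h₁ h₂
  exact hM ⟨x, y, z, hxy, hyz, hxz, by simpa, by simpa, by simpa⟩

/-- The edge underlying an arc. -/
def edgeOf (p : V × V) : Sym2 V := s(p.1, p.2)

theorem undirect_cons (e : V × V) (M : List (V × V)) :
    undirect (e :: M).toFinset = insert (edgeOf e) (undirect M.toFinset) := by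
  simp [undirect, edgeOf, Finset.image_insert]

theorem mem_map_erase_iff {α β : Type*} [BEq α] [LawfulBEq α] {f : α → β} {L : List α}
    (hL : (L.map f).Nodup) {e : α} (he : e ∈ L) (x : β) :
    x ∈ (L.erase e).map f ↔ x ∈ L.map f ∧ x ≠ f e := by
  have hp := (List.perm_cons_erase he).map f
  have hn := hp.nodup_iff.1 hL
  rw [hp.mem_iff]
  simp only [List.map_cons, List.nodup_cons, List.mem_cons] at hn ⊢
  grind

/-- `L` lists the free edges of the position `(M, B)` on the board `X`, each of them once. -/
def ListsFree (X : Finset (Sym2 V)) (M : List (V × V)) (B : Finset (Sym2 V))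
    (L : List (V × V)) : Prop :=
  (L.map edgeOf).Nodup ∧ ∀ a, a ∈ L.map edgeOf ↔ a ∈ X \ (undirect M.toFinset ∪ B)

theorem ListsFree.move {X : Finset (Sym2 V)} {M : List (V × V)} {B : Finset (Sym2 V)}
    {L : List (V × V)} (h : ListsFree X M B L) {e e' : V × V} (he : e ∈ L)
    (hee' : edgeOf e' = edgeOf e) : ListsFree X (e' :: M) B (L.erase e) := by
  refine ⟨h.1.sublist (List.erase_sublist.map _), fun a => ?_⟩
  rw [mem_map_erase_iff h.1 he, h.2, undirect_cons, hee']
  simp only [Finset.mem_sdiff, Finset.mem_union, Finset.mem_insert]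
  tauto

theorem ListsFree.reply {X : Finset (Sym2 V)} {M : List (V × V)} {B : Finset (Sym2 V)}
    {L : List (V × V)} (h : ListsFree X M B L) {g : V × V} (hg : g ∈ L) :
    ListsFree X M (B ∪ {edgeOf g}) (L.erase g) := by
  refine ⟨h.1.sublist (List.erase_sublist.map _), fun a => ?_⟩
  rw [mem_map_erase_iff h.1 hg, h.2]
  simp only [Finset.mem_sdiff, Finset.mem_union, Finset.mem_singleton]
  tauto

/-- Soundness of `answers`, given soundness of `blocks` for the same round bound. -/
theorem oBreakerTurn_of_answers_of_blocks {X : Finset (Sym2 V)} {n : ℕ}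
    (hblocks : ∀ {M : List (V × V)} {B : Finset (Sym2 V)} {L : List (V × V)},
      ¬ HasCyclicTriangle M.toFinset → ListsFree X M B L → blocks n M L = true →
      OBreakerBlock X HasCyclicTriangle 1 M.toFinset B)
    {M : List (V × V)} {e : V × V} {B : Finset (Sym2 V)} {R : List (V × V)}
    (hM : ¬ HasCyclicTriangle M.toFinset) (hR : ListsFree X (e :: M) B R)
    (h : answers n M e R = true) :
    OBreakerTurn X HasCyclicTriangle 1 (e :: M).toFinset B := by
  simp only [answers, Bool.and_eq_true, Bool.not_eq_true', Bool.or_eq_true, List.isEmpty_iff,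
    List.any_eq_true] at h
  obtain ⟨hc, h⟩ := h
  have hM' := not_hasCyclicTriangle_cons hM hc
  refine ⟨hM', ?_⟩
  rcases h with rfl | ⟨g, hg, hb⟩
  · have hX : X \ (undirect (e :: M).toFinset ∪ B) = ∅ := by
      refine Finset.eq_empty_of_forall_notMem fun a ha => ?_
      simpa using (hR.2 a).2 ha
    refine ⟨∅, by simp, by rw [hX]; simp, ?_⟩
    rw [Finset.union_empty]
    refine .of_forall_turn hM' fun x y h₁ h₂ => ?_
    exact absurd (hX ▸ Finset.mem_sdiff.2 ⟨h₁, h₂⟩) (Finset.notMem_empty _)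
  · have hgX := (hR.2 (edgeOf g)).1 (List.mem_map_of_mem hg)
    refine ⟨{edgeOf g}, Finset.singleton_subset_iff.2 hgX, ?_, hblocks hM' (hR.reply hg) hb⟩
    have := Finset.card_pos.2 ⟨_, hgX⟩
    rw [Finset.card_singleton]
    omega

theorem oBreakerBlock_of_blocks {X : Finset (Sym2 V)} (n : ℕ) :
    ∀ {M : List (V × V)} {B : Finset (Sym2 V)} {L : List (V × V)},
      ¬ HasCyclicTriangle M.toFinset → ListsFree X M B L → blocks n M L = true →
      OBreakerBlock X HasCyclicTriangle 1 M.toFinset B := by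
  induction n with
  | zero =>
    intro M B L hM hL h
    refine .of_forall_turn hM fun x y h₁ h₂ => ?_
    have hxy := (hL.2 s(x, y)).2 (Finset.mem_sdiff.2 ⟨h₁, h₂⟩)
    simp only [blocks, List.isEmpty_iff] at h
    simp [h] at hxy
  | succ n ih =>
    intro M B L hM hL h
    refine .of_forall_turn hM fun x y h₁ h₂ => ?_
    obtain ⟨e, he, hexy⟩ := List.mem_map.1 ((hL.2 s(x, y)).2 (Finset.mem_sdiff.2 ⟨h₁, h₂⟩))
    have hmem : (x, y) ∈ [e, e.swap] := by
      rcases e with ⟨u, v⟩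
      simpa [edgeOf, eq_comm, and_comm] using hexy
    have hans : answers n M (x, y) (L.erase e) = true := by
      rw [blocks, List.all_eq_true] at h
      exact List.all_eq_true.1 (h e he) _ hmem
    simpa using oBreakerTurn_of_answers_of_blocks ih hM (hL.move (e' := (x, y)) he hexy.symm) hans

theorem oBreakerTurn_of_answers {X : Finset (Sym2 V)} {n : ℕ} {M : List (V × V)} {e : V × V}
    {B : Finset (Sym2 V)} {R : List (V × V)} (hM : ¬ HasCyclicTriangle M.toFinset)
    (hR : ListsFree X (e :: M) B R) (h : answers n M e R = true) :
    OBreakerTurn X HasCyclicTriangle 1 (e :: M).toFinset B :=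
  oBreakerTurn_of_answers_of_blocks (oBreakerBlock_of_blocks n) hM hR h

/-- The edges of the 4-wheel, spokes first so that the search tries them first. -/
def W4arcs : List (Fin 5 × Fin 5) :=
  [(3, 4), (2, 4), (1, 4), (0, 4), (3, 0), (2, 3), (1, 2), (0, 1)]

/-- The edges of the 4-wheel that are left after the two given ones are taken. -/
def W4rest (p q : Fin 5 × Fin 5) : List (Fin 5 × Fin 5) :=
  W4arcs.filter fun a => edgeOf a ≠ edgeOf p ∧ edgeOf a ≠ edgeOf q

theorem listsFree_W4rest (p q : Fin 5 × Fin 5) : ListsFree W4edges [q, p] ∅ (W4rest p q) := by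
  have hnodup : (W4arcs.map edgeOf).Nodup := by decide
  have hedges : ∀ a, a ∈ W4edges ↔ a ∈ W4arcs.map edgeOf := by decide
  refine ⟨hnodup.sublist (List.filter_sublist.map _), fun a => ?_⟩
  rw [undirect_cons, undirect_cons, Finset.mem_sdiff, hedges]
  simp only [W4rest, List.mem_map, List.mem_filter, List.toFinset_nil, undirect,
    Finset.image_empty, Finset.union_empty, Finset.mem_insert, decide_eq_true_eq]
  grind

theorem answers_W4 : ∀ x₁ y₁ x₂ y₂ : Fin 5, s(x₁, y₁) ∈ W4edges → s(x₂, y₂) ∈ W4edges →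
    s(x₁, y₁) ≠ s(x₂, y₂) → ¬((4 : Fin 5) ∈ s(x₁, y₁) ∧ (4 : Fin 5) ∈ s(x₂, y₂)) →
    answers 3 [(x₁, y₁)] (x₂, y₂) (W4rest (x₁, y₁) (x₂, y₂)) = true := by
  decide +kernel

/-- On the 4-wheel `W₄`, Breaker prevents cyclic triangles in the
unbiased `T_C`-tournament game, even if Maker claims and orients two edges in her first
turn, provided not both are incident with the center. -/
theorem breaker_blocks_W4 :
    ∀ x₁ y₁ x₂ y₂ : Fin 5, s(x₁, y₁) ∈ W4edges → s(x₂, y₂) ∈ W4edges →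
      s(x₁, y₁) ≠ s(x₂, y₂) →
      ¬((4 : Fin 5) ∈ s(x₁, y₁) ∧ (4 : Fin 5) ∈ s(x₂, y₂)) →
      OBreakerTurn W4edges HasCyclicTriangle 1 {(x₁, y₁), (x₂, y₂)} ∅ := by
  intro x₁ y₁ x₂ y₂ h₁ h₂ hne hc
  have hM : ¬ HasCyclicTriangle [(x₁, y₁)].toFinset := by
    rintro ⟨x, y, z, hxy, -, -, h, h', -⟩
    simp only [List.toFinset_cons, List.toFinset_nil, insert_empty_eq, Finset.mem_singleton,
      Prod.mk.injEq] at h h'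
    exact hxy (h.1.trans h'.1.symm)
  have := oBreakerTurn_of_answers hM (listsFree_W4rest _ _) (answers_W4 x₁ y₁ x₂ y₂ h₁ h₂ hne hc)
  simpa [Finset.pair_comm] using this

end TournamentGame
end

section
/- Breaker has a strategy to prevent Maker from creating a cyclic (directed) triangle in the unbiased T_C-tournament game played on the edge set of K₅⁻, the complete graph on 5 vertices with one edge removed. -/
namespace TournamentGame

variable {V : Type*} [DecidableEq V]

/-- What has happened to an edge: nothing yet, claimed by Breaker, or claimed by Maker, who
chose one of the two orientations. -/
inductive Claim
  | free
  | breaker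
  | maker (b : Bool)
  deriving DecidableEq

namespace K5Minus

/-- The edges of `K₅⁻`, each with a reference orientation. -/
def ends : Fin 9 → Fin 5 × Fin 5 :=
  ![(0, 1), (0, 2), (1, 2), (0, 3), (1, 3), (2, 3), (0, 4), (1, 4), (2, 4)]

/-- The unoriented edge with a given index. -/
def edge (i : Fin 9) : Sym2 (Fin 5) := s((ends i).1, (ends i).2)

/-- The edge with a given index, oriented against the reference orientation if `b`. -/
def arc (i : Fin 9) (b : Bool) : Fin 5 × Fin 5 :=
  if b then (ends i).swap else ends i

/-- The edge set of `K₅⁻`. -/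
abbrev board : Finset (Sym2 (Fin 5)) := (completeEdges 5).erase s((3 : Fin 5), (4 : Fin 5))

/-- Maker's arcs in a position. -/
def makerArcs (s : Fin 9 → Claim) : Finset (Fin 5 × Fin 5) :=
  ({a | s a.1 = .maker a.2} : Finset (Fin 9 × Bool)).image fun a => arc a.1 a.2

/-- Breaker's edges in a position. -/
def breakerEdges (s : Fin 9 → Claim) : Finset (Sym2 (Fin 5)) :=
  ({i | s i = .breaker} : Finset (Fin 9)).image edge

/-- Breaker can block cyclic triangles from a position with Maker to move. -/
def Blocks (s : Fin 9 → Claim) : Prop :=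
  OBreakerBlock board HasCyclicTriangle 1 (makerArcs s) (breakerEdges s)

/-- The bit representing an arc in a bit mask. -/
def arcBit (i : ℕ) (b : Bool) : ℕ := 2 ^ (2 * i + b.toNat)

/-- The cyclic triangles of `K₅⁻`, as bit masks of arcs. -/
def cyclicTriangles : List ℕ :=
  [25, 385, 24577, 38, 1156, 73732, 578,
   2120, 36866, 135176, 1552, 98320, 2336, 147488]

/-- Some cyclic triangle is fully claimed by Maker. -/
def Lost (s : Fin 9 → Claim) : Prop :=
  ∃ t ∈ cyclicTriangles, ∀ (i : Fin 9) (b : Bool), t.testBit (2 * i + b.toNat) → s i = .maker b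

/-- Maker can no longer obtain a certain arc. -/
def Forbidden (s : Fin 9 → Claim) (i : Fin 9) (b : Bool) : Prop :=
  s i = .breaker ∨ s i = .maker !b

/-- Every cyclic triangle has an arc which Maker can no longer obtain. -/
def Dead (s : Fin 9 → Claim) : Prop :=
  ∀ t ∈ cyclicTriangles, ∃ (i : Fin 9) (b : Bool), t.testBit (2 * i + b.toNat) ∧ Forbidden s i b

section Board

theorem edge_injective : Function.Injective edge := by decide +kernel

theorem arc_inj : ∀ {i j : Fin 9} {b c : Bool}, arc i b = arc j c → i = j ∧ b = c := by
  decide +kernel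

theorem mk_arc (i : Fin 9) (b : Bool) : s((arc i b).1, (arc i b).2) = edge i := by
  cases b <;> simp [arc, edge, Sym2.eq_swap]

theorem edge_mem_board : ∀ i : Fin 9, edge i ∈ board := by decide +kernel

theorem exists_arc_of_mem_board :
    ∀ x y : Fin 5, s(x, y) ∈ board → ∃ i b, arc i b = (x, y) := by decide +kernel

theorem exists_edge_of_mem_board {e : Sym2 (Fin 5)} (he : e ∈ board) : ∃ i, edge i = e := by
  induction e using Sym2.ind with
  | _ x y =>
    obtain ⟨i, b, h⟩ := exists_arc_of_mem_board x y he
    exact ⟨i, by rw [← mk_arc i b, h]⟩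

theorem arcBits_mem_cyclicTriangles : ∀ (i j k : Fin 9) (b c d : Bool),
    (arc i b).2 = (arc j c).1 → (arc j c).2 = (arc k d).1 → (arc k d).2 = (arc i b).1 →
      arcBit i b ||| arcBit j c ||| arcBit k d ∈ cyclicTriangles := by
  decide +kernel

end Board

section Positions

variable {s : Fin 9 → Claim}

theorem mem_makerArcs {p : Fin 5 × Fin 5} :
    p ∈ makerArcs s ↔ ∃ i b, s i = .maker b ∧ arc i b = p := by
  simp [makerArcs]

theorem edge_mem_breakerEdges {i : Fin 9} : edge i ∈ breakerEdges s ↔ s i = .breaker := by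
  simp [breakerEdges, edge_injective.eq_iff]

theorem edge_mem_undirect {i : Fin 9} : edge i ∈ undirect (makerArcs s) ↔ ∃ b, s i = .maker b := by
  simp only [undirect, Finset.mem_image, mem_makerArcs]
  constructor
  · rintro ⟨_, ⟨j, b, hj, rfl⟩, h⟩
    rw [mk_arc] at h
    exact ⟨b, edge_injective h ▸ hj⟩
  · rintro ⟨b, h⟩
    exact ⟨_, ⟨i, b, h, rfl⟩, mk_arc i b⟩

theorem edge_notMem_claimed {i : Fin 9} :
    edge i ∉ undirect (makerArcs s) ∪ breakerEdges s ↔ s i = .free := by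
  rw [Finset.mem_union, edge_mem_undirect, edge_mem_breakerEdges]
  cases s i <;> simp

theorem makerArcs_update_maker {i : Fin 9} (hi : s i = .free) (b : Bool) :
    makerArcs (Function.update s i (.maker b)) = insert (arc i b) (makerArcs s) := by
  ext p
  simp only [Finset.mem_insert, mem_makerArcs, Function.update_apply]
  constructor
  · rintro ⟨j, c, h, rfl⟩
    grind
  · rintro (rfl | ⟨j, c, h, rfl⟩)
    · exact ⟨i, b, by simp, rfl⟩
    · exact ⟨j, c, by grind, rfl⟩

theorem breakerEdges_update_maker {i : Fin 9} (hi : s i = .free) (b : Bool) :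
    breakerEdges (Function.update s i (.maker b)) = breakerEdges s := by
  unfold breakerEdges
  congr 1
  ext j
  simp only [Finset.mem_filter_univ, Function.update_apply]
  grind

theorem makerArcs_update_breaker {i : Fin 9} (hi : s i = .free) :
    makerArcs (Function.update s i .breaker) = makerArcs s := by
  unfold makerArcs
  congr 1
  ext a
  simp only [Finset.mem_filter_univ, Function.update_apply]
  grind

theorem breakerEdges_update_breaker (i : Fin 9) :
    breakerEdges (Function.update s i .breaker) = breakerEdges s ∪ {edge i} := by
  ext e
  simp only [breakerEdges, Finset.mem_union, Finset.mem_image, Finset.mem_filter_univ,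
    Function.update_apply, Finset.mem_singleton]
  grind

theorem undirect_insert (M : Finset (Fin 5 × Fin 5)) (p : Fin 5 × Fin 5) :
    undirect (insert p M) = insert s(p.1, p.2) (undirect M) :=
  Finset.image_insert ..

theorem testBit_arcBit {i j : Fin 9} {b c : Bool} :
    (arcBit i b).testBit (2 * j + c.toNat) = true ↔ i = j ∧ b = c := by
  rw [arcBit, Nat.testBit_two_pow]
  cases b <;> cases c <;> simp [Fin.ext_iff] <;> omega

theorem Lost.of_hasCyclicTriangle (h : HasCyclicTriangle (makerArcs s)) : Lost s := by
  obtain ⟨x, y, z, -, -, -, h₁, h₂, h₃⟩ := h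
  obtain ⟨i, b, hi, hi'⟩ := mem_makerArcs.1 h₁
  obtain ⟨j, c, hj, hj'⟩ := mem_makerArcs.1 h₂
  obtain ⟨k, d, hk, hk'⟩ := mem_makerArcs.1 h₃
  refine ⟨_, arcBits_mem_cyclicTriangles i j k b c d (by simp [*]) (by simp [*]) (by simp [*]),
    fun l e hl => ?_⟩
  simp only [Nat.testBit_or, Bool.or_eq_true, testBit_arcBit] at hl
  grind

theorem blocks_of_reply (hs : ¬ Lost s)
    (h : ∀ i b, s i = .free →
      ((∀ j, Function.update s i (.maker b) j ≠ .free) ∧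
        Blocks (Function.update s i (.maker b))) ∨
      ∃ j, Function.update s i (.maker b) j = .free ∧
        Blocks (Function.update (Function.update s i (.maker b)) j .breaker)) :
    Blocks s := by
  have key : ∀ x y : Fin 5, s(x, y) ∈ board →
      s(x, y) ∉ undirect (makerArcs s) ∪ breakerEdges s →
      ∃ R : Finset (Sym2 (Fin 5)),
        R ⊆ board \ (insert s(x, y) (undirect (makerArcs s)) ∪ breakerEdges s) ∧
        R.card =
          min 1 (board \ (insert s(x, y) (undirect (makerArcs s)) ∪ breakerEdges s)).card ∧
        OBreakerBlock board HasCyclicTriangle 1 (insert (x, y) (makerArcs s))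
          (breakerEdges s ∪ R) := by
    intro x y hX hfree
    obtain ⟨i, b, hxy⟩ := exists_arc_of_mem_board x y hX
    have hi : s i = .free := by
      rw [← edge_notMem_claimed, ← mk_arc i b, hxy]
      exact hfree
    have hM : insert (x, y) (makerArcs s) = makerArcs (Function.update s i (.maker b)) := by
      rw [makerArcs_update_maker hi, hxy]
    have hU : insert s(x, y) (undirect (makerArcs s)) =
        undirect (makerArcs (Function.update s i (.maker b))) := by
      rw [← hM, undirect_insert]
    rw [hM, hU, ← breakerEdges_update_maker hi b]
    have hr := h i b hi
    generalize Function.update s i (.maker b) = t at hr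
    rcases hr with ⟨hall, hb⟩ | ⟨j, hj, hb⟩
    · have hempty : board \ (undirect (makerArcs t) ∪ breakerEdges t) = ∅ := by
        refine Finset.sdiff_eq_empty_iff_subset.2 fun e he => ?_
        obtain ⟨j, rfl⟩ := exists_edge_of_mem_board he
        by_contra hj
        exact hall j (edge_notMem_claimed.1 hj)
      refine ⟨∅, Finset.empty_subset _, by simp [hempty], ?_⟩
      rwa [Finset.union_empty]
    · have hmem : edge j ∈ board \ (undirect (makerArcs t) ∪ breakerEdges t) :=
        Finset.mem_sdiff.2 ⟨edge_mem_board j, edge_notMem_claimed.2 hj⟩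
      refine ⟨{edge j}, Finset.singleton_subset_iff.2 hmem, ?_, ?_⟩
      · rw [Finset.card_singleton, min_eq_left (Finset.card_pos.2 ⟨_, hmem⟩)]
      · rwa [← breakerEdges_update_breaker, ← makerArcs_update_breaker hj]
  choose! resp hsub hcard hblock using key
  exact .step _ _ (fun hF => hs (.of_hasCyclicTriangle hF)) resp hsub hcard hblock

theorem Dead.update (h : Dead s) {i : Fin 9} (hi : s i = .free) (c : Claim) :
    Dead (Function.update s i c) := by
  intro t ht
  obtain ⟨j, b, hj, hf⟩ := h t ht
  refine ⟨j, b, hj, ?_⟩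
  have hij : j ≠ i := by
    rintro rfl
    simp [Forbidden, hi] at hf
  simpa [Forbidden, Function.update_of_ne hij] using hf

theorem Dead.not_lost (h : Dead s) : ¬ Lost s := by
  rintro ⟨t, ht, hm⟩
  obtain ⟨i, b, hi, hf⟩ := h t ht
  simp [Forbidden, hm i b hi] at hf

theorem card_free_update_lt {i : Fin 9} (hi : s i = .free) {c : Claim} (hc : c ≠ .free) :
    ({j | Function.update s i c j = .free} : Finset (Fin 9)).card <
      ({j | s j = .free} : Finset (Fin 9)).card := by
  refine Finset.card_lt_card (Finset.ssubset_iff_of_subset ?_ |>.2 ⟨i, by simpa, by simpa⟩)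
  intro j
  simp only [Finset.mem_filter_univ, Function.update_apply]
  grind

theorem Dead.blocks {s : Fin 9 → Claim} (h : Dead s) : Blocks s := by
  refine blocks_of_reply h.not_lost fun i b hi => ?_
  have hlt := card_free_update_lt hi (c := .maker b) (by simp)
  by_cases hj : ∃ j, Function.update s i (.maker b) j = .free
  · obtain ⟨j, hj⟩ := hj
    have hlt' := card_free_update_lt hj (c := .breaker) (by simp)
    exact .inr ⟨j, hj, ((h.update hi _).update hj _).blocks⟩
  · exact .inl ⟨not_exists.1 hj, (h.update hi _).blocks⟩
termination_by ({j | s j = .free} : Finset (Fin 9)).card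
decreasing_by all_goals omega

theorem blocks_of_dead_reply (hs : ¬ Lost s)
    (h : ∀ i b, s i = .free →
      Dead (Function.update s i (.maker b)) ∨
      ∃ j, Function.update s i (.maker b) j = .free ∧
        Blocks (Function.update (Function.update s i (.maker b)) j .breaker)) :
    Blocks s := by
  refine blocks_of_reply hs fun i b hi => ?_
  refine (h i b hi).elim (fun hd => ?_) .inr
  by_cases hj : ∃ j, Function.update s i (.maker b) j = .free
  · obtain ⟨j, hj⟩ := hj
    exact .inr ⟨j, hj, (hd.update hj _).blocks⟩
  · exact .inl ⟨not_exists.1 hj, hd.blocks⟩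

end Positions

section Search

/-- Maker, owning the arcs in `m`, lacks at most one arc of some triangle in `L`. -/
def hasThreat (m : ℕ) (L : List ℕ) : Bool :=
  L.any fun t => ((t - t.land m).land (t - t.land m - 1)).beq 0

/-- The triangles in `L` without an arc in `d`. -/
def alive (d : ℕ) (L : List ℕ) : List ℕ := L.filter fun t => (t.land d).beq 0

/-- Both orientations of an edge, as a bit mask. -/
def edgeBits (i : ℕ) : ℕ := (arcBit i false).lor (arcBit i true)

/-- The edge `i` is unclaimed, when Maker owns the arcs in `m` and can no longer obtain those
in `d`. -/
def isFree (m d i : ℕ) : Bool := ((m.lor d).land (arcBit i false)).beq 0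

/-- The order in which Breaker tries his replies. -/
def replyOrder : List ℕ := [1, 7, 4, 2, 3, 5, 0, 6, 8]

/-- Search for a Breaker strategy with Maker to move. Maker owns the arcs in `m`, can no longer
obtain those in `d`, and `L` lists the cyclic triangles she might still complete. -/
def search : ℕ → ℕ → ℕ → List ℕ → Bool
  | 0, _, _, L => L.isEmpty
  | n + 1, m, d, L => L.isEmpty || (!hasThreat m L && (List.range 9).all fun i =>
      !isFree m d i || [false, true].all fun b =>
        (alive (d.lor (arcBit i !b)) L).isEmpty ||
        replyOrder.any fun j =>
          isFree (m.lor (arcBit i b)) (d.lor (arcBit i !b)) j &&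
            search n (m.lor (arcBit i b)) ((d.lor (arcBit i !b)).lor (edgeBits j))
              (alive (edgeBits j) (alive (d.lor (arcBit i !b)) L)))

/-- The data of `search` describe the position `s`. -/
structure Encodes (s : Fin 9 → Claim) (m d : ℕ) (L : List ℕ) : Prop where
  maker (i : Fin 9) (b : Bool) : m.testBit (2 * i + b.toNat) ↔ s i = .maker b
  forbidden (i : Fin 9) (b : Bool) : d.testBit (2 * i + b.toNat) ↔ Forbidden s i b
  alive : ∀ t ∈ cyclicTriangles, t.land d = 0 → t ∈ L

variable {s : Fin 9 → Claim} {m d : ℕ} {L : List ℕ}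

theorem cyclicTriangles_lt : ∀ t ∈ cyclicTriangles, t < 2 ^ 18 := by decide

theorem exists_arc_of_testBit {t k : ℕ} (ht : t < 2 ^ 18) (hk : t.testBit k) :
    ∃ (i : Fin 9) (b : Bool), k = 2 * i + b.toNat := by
  have hk18 : k < 18 := by
    by_contra! h
    rw [Nat.testBit_lt_two_pow (ht.trans_le (Nat.pow_le_pow_right two_pos h))] at hk
    simp at hk
  refine ⟨⟨k / 2, by omega⟩, k.testBit 0, ?_⟩
  rw [Nat.testBit_zero]
  rcases Nat.mod_two_eq_zero_or_one k with h | h <;> simp [h] <;> omega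

theorem exists_testBit_of_land_ne_zero {t d : ℕ} (h : t.land d ≠ 0) :
    ∃ k, t.testBit k ∧ d.testBit k := by
  obtain ⟨k, hk⟩ := Nat.exists_testBit_of_ne_zero h
  exact ⟨k, by simpa using (Nat.testBit_and t d k).symm.trans hk⟩

theorem Encodes.dead (h : Encodes s m d []) : Dead s := by
  intro t ht
  obtain ⟨k, hk, hkd⟩ := exists_testBit_of_land_ne_zero fun h0 => by simpa using h.alive t ht h0
  obtain ⟨i, b, rfl⟩ := exists_arc_of_testBit (cyclicTriangles_lt t ht) hk
  exact ⟨i, b, hk, (h.forbidden i b).1 hkd⟩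

theorem Encodes.not_lost (h : Encodes s m d L) (hL : hasThreat m L = false) : ¬ Lost s := by
  rintro ⟨t, ht, hm⟩
  have hd : t.land d = 0 := by
    by_contra h0
    obtain ⟨k, hk, hkd⟩ := exists_testBit_of_land_ne_zero h0
    obtain ⟨i, b, rfl⟩ := exists_arc_of_testBit (cyclicTriangles_lt t ht) hk
    have := (h.forbidden i b).1 hkd
    simp [Forbidden, hm i b hk] at this
  have htm : t.land m = t := by
    refine Nat.eq_of_testBit_eq fun k => (Nat.testBit_and t m k).trans ?_
    by_cases hk : t.testBit k = true
    · obtain ⟨i, b, rfl⟩ := exists_arc_of_testBit (cyclicTriangles_lt t ht) hk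
      simp [hk, (h.maker i b).2 (hm i b hk)]
    · simp [hk]
  have := List.any_eq_false.1 hL t (h.alive t ht hd)
  rw [htm, Nat.sub_self] at this
  exact this (by decide)

theorem testBit_lor {m n k : ℕ} : (m.lor n).testBit k ↔ m.testBit k ∨ n.testBit k := by
  rw [← Bool.or_eq_true, ← Nat.testBit_or]
  rfl

theorem mem_alive {t : ℕ} : t ∈ alive d L ↔ t ∈ L ∧ t.land d = 0 := by
  simp [alive]

theorem land_lor_eq_zero {t a b : ℕ} : t.land (a.lor b) = 0 ↔ t.land a = 0 ∧ t.land b = 0 := by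
  have : t.land (a.lor b) = (t.land a).lor (t.land b) := Nat.and_or_distrib_left t a b
  rw [this]
  exact Nat.or_eq_zero_iff

theorem Encodes.isFree_iff (h : Encodes s m d L) (i : Fin 9) : isFree m d i ↔ s i = .free := by
  have hbit : isFree m d i ↔ ¬ (m.lor d).testBit (2 * i + false.toNat) := by
    have : (m.lor d).land (arcBit i false) = _ := Nat.and_two_pow (m.lor d) _
    rw [isFree, this]
    cases (m.lor d).testBit (2 * i + false.toNat) <;> simp
  rw [hbit, testBit_lor, h.maker, h.forbidden, Forbidden]
  rcases s i with _ | _ | _ | _ <;> simp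

theorem Encodes.makerMove (h : Encodes s m d L) {i : Fin 9} (hi : s i = .free) (b : Bool) :
    Encodes (Function.update s i (.maker b)) (m.lor (arcBit i b)) (d.lor (arcBit i !b))
      (K5Minus.alive (d.lor (arcBit i !b)) L) where
  maker j c := by
    rw [testBit_lor, h.maker, testBit_arcBit, Function.update_apply]
    grind
  forbidden j c := by
    rw [testBit_lor, h.forbidden, testBit_arcBit, Forbidden, Forbidden, Function.update_apply]
    cases b <;> cases c <;> grind
  alive t ht h0 := mem_alive.2 ⟨h.alive t ht (land_lor_eq_zero.1 h0).1, h0⟩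

theorem Encodes.breakerMove (h : Encodes s m d L) {j : Fin 9} (hj : s j = .free) :
    Encodes (Function.update s j .breaker) m (d.lor (edgeBits j))
      (K5Minus.alive (edgeBits j) L) where
  maker i c := by
    rw [h.maker, Function.update_apply]
    grind
  forbidden i c := by
    rw [testBit_lor, h.forbidden, edgeBits, testBit_lor, testBit_arcBit, testBit_arcBit,
      Forbidden, Forbidden, Function.update_apply]
    grind
  alive t ht h0 :=
    have h0' := land_lor_eq_zero.1 h0
    mem_alive.2 ⟨h.alive t ht h0'.1, h0'.2⟩

theorem lt_of_mem_replyOrder : ∀ j ∈ replyOrder, j < 9 := by decide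

theorem Encodes.blocks_of_search {n : ℕ} (h : Encodes s m d L) (hn : search n m d L) :
    Blocks s := by
  induction n generalizing s m d L with
  | zero =>
    obtain rfl := List.isEmpty_iff.1 hn
    exact h.dead.blocks
  | succ n ih =>
    rw [search, Bool.or_eq_true, Bool.and_eq_true, Bool.not_eq_true', List.isEmpty_iff] at hn
    obtain rfl | ⟨hL, hn⟩ := hn
    · exact h.dead.blocks
    refine blocks_of_dead_reply (h.not_lost hL) fun i b hi => ?_
    have hi' := List.all_eq_true.1 hn i (by simp)
    rw [(h.isFree_iff i).2 hi, Bool.not_true, Bool.false_or] at hi'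
    have hb := List.all_eq_true.1 hi' b (by cases b <;> simp)
    have hm := h.makerMove hi b
    rw [Bool.or_eq_true, List.isEmpty_iff, List.any_eq_true] at hb
    refine hb.imp (fun h0 => (h0 ▸ hm).dead) ?_
    rintro ⟨j, hj, hr⟩
    lift j to Fin 9 using lt_of_mem_replyOrder j hj
    rw [Bool.and_eq_true, hm.isFree_iff] at hr
    exact ⟨j, hr.1, ih (hm.breakerMove hr.1) hr.2⟩

theorem search_start : search 5 0 0 cyclicTriangles := by
  decide +kernel

theorem encodes_start : Encodes (fun _ => .free) 0 0 cyclicTriangles where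
  maker i b := by simp
  forbidden i b := by simp [Forbidden]
  alive t ht _ := ht

end Search

end K5Minus

/-- On `K₅⁻` (the complete graph on 5 vertices minus one edge), Breaker
prevents cyclic triangles in the unbiased `T_C`-tournament game. -/
theorem breaker_blocks_K5_minus :
    OBreakerBlock ((completeEdges 5).erase s((3 : Fin 5), (4 : Fin 5)))
      HasCyclicTriangle 1 ∅ ∅ := by
  simpa [K5Minus.Blocks, K5Minus.makerArcs, K5Minus.breakerEdges] using
    K5Minus.encodes_start.blocks_of_search K5Minus.search_start

end TournamentGame
end
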